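/- arXiv:2602.14142 — 7 statements merged into one kernel-verified Lean document; each statement's English description precedes it below -/
import Mathlib

section
/- Let Π be the 2×3 matrix [[−1,1,0],[−1,0,1]] and, for x = (x₀,x₁,x₂) ∈ Δ̄, let H(x) be the 3×2 matrix with rows (−x₁,−x₂), (1−x₁,−x₂), (−x₁,1−x₂), and define the 2×2 real matrix D^{(n)}(x) = Π·A^{(n)}(x)·H(x). Then D is a cocycle over f_R: for all m, n ∈ ℕ and every x ∈ Δ̄, D^{(m+n)}(x) = D^{(m)}(f_R^n x)·D^{(n)}(x). -/
open MeasureTheory Matrix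

noncomputable section

/-- The four matrices of the Reverse algorithm. -/
def M1 : Matrix (Fin 3) (Fin 3) ℝ := !![1,1,1; 0,1,0; 0,0,1]
def M2 : Matrix (Fin 3) (Fin 3) ℝ := !![1,0,0; 1,1,1; 0,0,1]
def M3 : Matrix (Fin 3) (Fin 3) ℝ := !![1,0,0; 0,1,0; 1,1,1]
def M4 : Matrix (Fin 3) (Fin 3) ℝ := !![0,1,1; 1,0,1; 1,1,0]

def Mat : Fin 4 → Matrix (Fin 3) (Fin 3) ℝ := ![M1, M2, M3, M4]

/-- The closed standard 2-simplex in ℝ³. -/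
def simplexBar : Set (Fin 3 → ℝ) := {x | (∀ i, 0 ≤ x i) ∧ x 0 + x 1 + x 2 = 1}

/-- The open standard 2-simplex in ℝ³. -/
def simplexOpen : Set (Fin 3 → ℝ) := {x | (∀ i, 0 < x i) ∧ x 0 + x 1 + x 2 = 1}

/-- The projectivized Reverse algorithm map. -/
def fR (x : Fin 3 → ℝ) : Fin 3 → ℝ :=
  if 1 < 2 * x 0 then ![(x 0 - x 1 - x 2) / x 0, x 1 / x 0, x 2 / x 0]
  else if 1 < 2 * x 1 then ![x 0 / x 1, (-x 0 + x 1 - x 2) / x 1, x 2 / x 1]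
  else if 1 < 2 * x 2 then ![x 0 / x 2, x 1 / x 2, (-x 0 - x 1 + x 2) / x 2]
  else ![-x 0 + x 1 + x 2, x 0 - x 1 + x 2, x 0 + x 1 - x 2]

/-- The digit `a(x)` of a point: the index of the cell `Δ(a(x))` containing `x`. -/
def digit (x : Fin 3 → ℝ) : Fin 4 :=
  if 1 < 2 * x 0 then 0 else if 1 < 2 * x 1 then 1 else if 1 < 2 * x 2 then 2 else 3

/-- The cocycle `A^{(n)}(x) = ᵗM_{a(f^{n-1}x)} ⋯ ᵗM_{a(fx)} ᵗM_{a(x)}`. -/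
def Acoc : ℕ → (Fin 3 → ℝ) → Matrix (Fin 3) (Fin 3) ℝ
  | 0, _ => 1
  | n+1, x => Acoc n (fR x) * (Mat (digit x))ᵀ

/-- The invariant measure μ of the Reverse algorithm: in coordinates (x₁,x₂) it has
density 4/(π²(x₁+x₂)(1-x₁)(1-x₂)) on the open triangle. -/
def muR : Measure (Fin 3 → ℝ) :=
  Measure.map (fun p : ℝ × ℝ => ![1 - p.1 - p.2, p.1, p.2])
    (((volume : Measure (ℝ × ℝ)).restrict
        {p : ℝ × ℝ | 0 < p.1 ∧ 0 < p.2 ∧ p.1 + p.2 < 1}).withDensity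
      (fun p => ENNReal.ofReal (4 / (Real.pi ^ 2 * (p.1 + p.2) * (1 - p.1) * (1 - p.2)))))


/-- The 2×3 projection matrix Π. -/
def Pi23 : Matrix (Fin 2) (Fin 3) ℝ := !![-1,1,0; -1,0,1]

/-- The 3×2 matrix H(x). -/
def Hmat (x : Fin 3 → ℝ) : Matrix (Fin 3) (Fin 2) ℝ :=
  !![-x 1, -x 2; 1 - x 1, -x 2; -x 1, 1 - x 2]

/-- The 2×2 matrices `D^{(n)}(x) = Π · A^{(n)}(x) · H(x)`. -/
def Dcoc (n : ℕ) (x : Fin 3 → ℝ) : Matrix (Fin 2) (Fin 2) ℝ :=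
  Pi23 * Acoc n x * Hmat x

lemma fR_sum {x : Fin 3 → ℝ} (hx : x 0 + x 1 + x 2 = 1) :
    fR x 0 + fR x 1 + fR x 2 = 1 := by
  unfold fR
  split_ifs with h0 h1 h2
  · have : x 0 ≠ 0 := by linarith
    simp
    field_simp
    ring
  · have : x 1 ≠ 0 := by linarith
    simp
    field_simp
    ring
  · have : x 2 ≠ 0 := by linarith
    simp
    field_simp
    ring
  · simp
    linarith

/-- `fR` is the projectivization of the inverse of the branch matrix. -/
lemma exists_fR_vecMul_Mat_transpose (x : Fin 3 → ℝ) :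
    ∃ c : ℝ, fR x ᵥ* (Mat (digit x))ᵀ = c • x := by
  unfold fR digit
  split_ifs with h0 h1 h2
  · have : x 0 ≠ 0 := by linarith
    refine ⟨(x 0)⁻¹, ?_⟩
    ext i
    fin_cases i <;> simp [Mat, M1, vecMul, dotProduct, Fin.sum_univ_three] <;> field_simp <;> ring
  · have : x 1 ≠ 0 := by linarith
    refine ⟨(x 1)⁻¹, ?_⟩
    ext i
    fin_cases i <;> simp [Mat, M2, vecMul, dotProduct, Fin.sum_univ_three] <;> field_simp <;> ring
  · have : x 2 ≠ 0 := by linarith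
    refine ⟨(x 2)⁻¹, ?_⟩
    ext i
    fin_cases i <;> simp [Mat, M3, vecMul, dotProduct, Fin.sum_univ_three] <;> field_simp <;> ring
  · refine ⟨2, ?_⟩
    ext i
    fin_cases i <;> simp [Mat, M4, vecMul, dotProduct, Fin.sum_univ_three] <;> ring

lemma iterate_fR_sum (n : ℕ) {x : Fin 3 → ℝ} (hx : x 0 + x 1 + x 2 = 1) :
    fR^[n] x 0 + fR^[n] x 1 + fR^[n] x 2 = 1 := by
  induction n generalizing x with
  | zero => exact hx
  | succ n ih => exact ih (fR_sum hx)

lemma exists_iterate_fR_vecMul_Acoc (n : ℕ) (x : Fin 3 → ℝ) :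
    ∃ c : ℝ, fR^[n] x ᵥ* Acoc n x = c • x := by
  induction n generalizing x with
  | zero => exact ⟨1, by simp [Acoc]⟩
  | succ n ih =>
    obtain ⟨c, hc⟩ := ih (fR x)
    obtain ⟨d, hd⟩ := exists_fR_vecMul_Mat_transpose x
    refine ⟨c * d, ?_⟩
    rw [Function.iterate_succ_apply, Acoc, ← vecMul_vecMul, hc, smul_vecMul, hd, smul_smul]

lemma Acoc_add (m n : ℕ) (x : Fin 3 → ℝ) :
    Acoc (m + n) x = Acoc m (fR^[n] x) * Acoc n x := by
  induction n generalizing x with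
  | zero => simp [Acoc]
  | succ n ih =>
    rw [← Nat.add_assoc, Acoc, ih, Function.iterate_succ_apply, Acoc, Matrix.mul_assoc]

lemma vecMul_Hmat {x : Fin 3 → ℝ} (hx : x 0 + x 1 + x 2 = 1) : x ᵥ* Hmat x = 0 := by
  ext i
  fin_cases i <;> simp [Hmat, vecMul, dotProduct, Fin.sum_univ_three]
  · linear_combination (-x 1) * hx
  · linear_combination (-x 2) * hx

/-- `H(x) Π` is the projection onto the orthogonal complement of `x` along `(1, 1, 1)`. -/
lemma Hmat_mul_Pi23 {x : Fin 3 → ℝ} (hx : x 0 + x 1 + x 2 = 1) :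
    Hmat x * Pi23 = 1 - vecMulVec 1 x := by
  ext i j
  fin_cases i <;> fin_cases j <;>
    simp [Hmat, Pi23, Matrix.mul_apply, Fin.sum_univ_two] <;> linarith

/-- `D` is a cocycle over f_R: `D^{(m+n)}(x) = D^{(m)}(f_R^n x) · D^{(n)}(x)`
for all m, n and every x in the closed simplex. -/
theorem D_is_cocycle :
    ∀ m n : ℕ, ∀ x ∈ simplexBar, Dcoc (m + n) x = Dcoc m (fR^[n] x) * Dcoc n x := by
  intro m n x hx
  have hy := iterate_fR_sum n hx.2
  obtain ⟨c, hc⟩ := exists_iterate_fR_vecMul_Acoc n x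
  have hz : vecMulVec (1 : Fin 3 → ℝ) (fR^[n] x) * (Acoc n x * Hmat x) = 0 := by
    rw [vecMulVec_mul, ← vecMul_vecMul, hc, smul_vecMul, vecMul_Hmat hx.2, smul_zero]
    ext i j
    simp [vecMulVec_apply]
  calc Dcoc (m + n) x
      = Pi23 * Acoc m (fR^[n] x) * (Acoc n x * Hmat x) := by
        simp only [Dcoc, Acoc_add, Matrix.mul_assoc]
    _ = Pi23 * Acoc m (fR^[n] x) * (Hmat (fR^[n] x) * Pi23 * (Acoc n x * Hmat x)) := by
        rw [Hmat_mul_Pi23 hy, Matrix.sub_mul, hz, Matrix.one_mul, sub_zero]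
    _ = Dcoc m (fR^[n] x) * Dcoc n x := by
        simp only [Dcoc, Matrix.mul_assoc]

end
end

section
/- Let σ ∈ {σ₁,σ₂,σ₃}, let C > 0, and let (v₁,v₂) be a C-letter balanced pair of finite words over {1,2,3} with |v₁| = |v₂|. If |σ(v₁)| ≤ |σ(v₂)| and w is a factor of σ(v₂) with |w| = |σ(v₁)|, then the pair (σ(v₁), w) is C-letter balanced. -/
/-- Finite words over the alphabet {1,2,3}, encoded as lists over `Fin 3`
(letter k+1 is encoded by `k : Fin 3`). -/
abbrev Word := List (Fin 3)

/-- The substitution σ₁ : 1↦1, 2↦21, 3↦31. -/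
def s1 : Fin 3 → Word := ![[0], [1,0], [2,0]]
/-- The substitution σ₂ : 1↦12, 2↦2, 3↦32. -/
def s2 : Fin 3 → Word := ![[0,1], [1], [2,1]]
/-- The substitution σ₃ : 1↦13, 2↦23, 3↦3. -/
def s3 : Fin 3 → Word := ![[0,2], [1,2], [2]]
/-- The substitution σ₄ : 1↦23, 2↦31, 3↦12. -/
def s4 : Fin 3 → Word := ![[1,2], [2,0], [0,1]]

/-- Apply a substitution to a word (the monoid-endomorphism extension). -/
def subApply (σ : Fin 3 → Word) (w : Word) : Word := w.flatMap σ

/-- A pair of words is C-letter balanced if the numbers of occurrences of each letter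
differ by at most C. -/
def balancedPair (C : ℝ) (v₁ v₂ : Word) : Prop :=
  ∀ i : Fin 3, |(v₁.count i : ℝ) - (v₂.count i : ℝ)| ≤ C

/-- A word is C-letter balanced if every pair of its factors of equal length
is C-letter balanced. -/
def balancedWord (C : ℝ) (u : Word) : Prop :=
  ∀ v₁ v₂ : Word, v₁ <:+: u → v₂ <:+: u → v₁.length = v₂.length → balancedPair C v₁ v₂

theorem length_eq_sum_count (w : Word) :
    w.length = w.count 0 + w.count 1 + w.count 2 := by
  induction w with
  | nil => rfl
  | cons a w ih => fin_cases a <;> simp <;> omega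

/-- Each of `s1`, `s2`, `s3` has a distinguished letter `k` that occurs once in the image of every
letter; the other letters keep their multiplicities. -/
theorem exists_count_subApply {σ : Fin 3 → Word} (hσ : σ = s1 ∨ σ = s2 ∨ σ = s3) :
    ∃ k : Fin 3, ∀ (v : Word) (i : Fin 3),
      (subApply σ v).count i = if i = k then v.length else v.count i := by
  obtain ⟨k, hk⟩ : ∃ k : Fin 3, ∀ a i : Fin 3,
      (σ a).count i = if i = k then 1 else [a].count i := by
    rcases hσ with rfl | rfl | rfl
    exacts [⟨0, by decide⟩, ⟨1, by decide⟩, ⟨2, by decide⟩]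
  refine ⟨k, fun v i => ?_⟩
  induction v with
  | nil => simp [subApply]
  | cons a v ih =>
    have ih' : (v.flatMap σ).count i = _ := ih
    rw [subApply, List.flatMap_cons, List.count_append, ih', hk]
    split_ifs
    · rw [List.length_cons, Nat.add_comm]
    · rw [← List.count_append, List.singleton_append]

/-- If (v₁,v₂) is C-letter balanced with |v₁| = |v₂|, σ ∈ {σ₁,σ₂,σ₃},
|σ(v₁)| ≤ |σ(v₂)|, and w is a factor of σ(v₂) with |w| = |σ(v₁)|,
then (σ(v₁), w) is C-letter balanced. -/
theorem balanced_pair_substitution (σ : Fin 3 → Word) (hσ : σ = s1 ∨ σ = s2 ∨ σ = s3)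
    (C : ℝ) (hC : 0 < C) (v₁ v₂ : Word) (hlen : v₁.length = v₂.length)
    (hbal : balancedPair C v₁ v₂)
    (hle : (subApply σ v₁).length ≤ (subApply σ v₂).length)
    (w : Word) (hw : w <:+: subApply σ v₂)
    (hwlen : w.length = (subApply σ v₁).length) :
    balancedPair C (subApply σ v₁) w := by
  obtain ⟨k, hk⟩ := exists_count_subApply hσ
  have hsub (i : Fin 3) : (w.count i : ℝ) ≤ (subApply σ v₂).count i := by
    exact_mod_cast hw.sublist.count_le i
  have hcount (v : Word) : (v.length : ℝ) = v.count 0 + v.count 1 + v.count 2 := by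
    exact_mod_cast length_eq_sum_count v
  have hlen' : (v₁.length : ℝ) = v₂.length := by exact_mod_cast hlen
  have hwlen' : (w.length : ℝ) = (subApply σ v₁).length := by exact_mod_cast hwlen
  have hle' : ((subApply σ v₁).length : ℝ) ≤ (subApply σ v₂).length := by exact_mod_cast hle
  have h₁ := hcount v₁
  have h₂ := hcount v₂
  rw [hcount w, hcount (subApply σ v₁)] at hwlen'
  rw [hcount (subApply σ v₁), hcount (subApply σ v₂)] at hle'
  obtain ⟨l0, u0⟩ := abs_le.mp (hbal 0)
  obtain ⟨l1, u1⟩ := abs_le.mp (hbal 1)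
  obtain ⟨l2, u2⟩ := abs_le.mp (hbal 2)
  have w0 := hsub 0
  have w1 := hsub 1
  have w2 := hsub 2
  intro i
  rw [abs_le]
  fin_cases k <;> fin_cases i <;>
    simp [hk, -Nat.cast_le] at w0 w1 w2 hwlen' hle' ⊢ <;> constructor <;> linarith
end

section
/- Let C > 0 and let u be a finite word over {1,2,3} that is C-letter balanced. Then σᵢ(u) is (C+4)-letter balanced for each i ∈ {1,2,3}, and σ₄(u) is (C+2)-letter balanced. -/
theorem exists_prefix_flatMap {σ : Fin 3 → Word}
    (hσ : ∀ a, (∃ x, σ a = [x]) ∨ ∃ x y, σ a = [x, y]) (u w : Word) (h : w <+: u.flatMap σ) :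
    ∃ v p : Word, v <+: u ∧ p.length ≤ 1 ∧ w = v.flatMap σ ++ p := by
  induction u generalizing w with
  | nil => exact ⟨[], [], List.nil_prefix, by simp, by simpa using h⟩
  | cons a u ih =>
    rw [List.flatMap_cons] at h
    rcases hσ a with ⟨x, hx⟩ | ⟨x, y, hx⟩
    · rw [hx, List.singleton_append, List.prefix_cons_iff] at h
      rcases h with rfl | ⟨t, rfl, ht⟩
      · exact ⟨[], [], List.nil_prefix, by simp, rfl⟩
      · obtain ⟨v, p, hv, hp, rfl⟩ := ih t ht
        exact ⟨a :: v, p, by simpa using hv, hp, by simp [hx]⟩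
    · rw [hx, List.cons_append, List.singleton_append, List.prefix_cons_iff] at h
      rcases h with rfl | ⟨t, rfl, ht⟩
      · exact ⟨[], [], List.nil_prefix, by simp, rfl⟩
      rw [List.prefix_cons_iff] at ht
      rcases ht with rfl | ⟨t, rfl, ht⟩
      · exact ⟨[], [x], List.nil_prefix, by simp, rfl⟩
      · obtain ⟨v, p, hv, hp, rfl⟩ := ih t ht
        exact ⟨a :: v, p, by simpa using hv, hp, by simp [hx]⟩

theorem exists_infix_flatMap {σ : Fin 3 → Word}
    (hσ : ∀ a, (∃ x, σ a = [x]) ∨ ∃ x y, σ a = [x, y]) (u w : Word) (h : w <:+: u.flatMap σ) :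
    ∃ v s p : Word, v <:+: u ∧ s.length ≤ 1 ∧ p.length ≤ 1 ∧ w = s ++ (v.flatMap σ ++ p) := by
  induction u with
  | nil => exact ⟨[], [], [], List.nil_infix, by simp, by simp, by simpa using h⟩
  | cons a u ih =>
    have of_prefix (h : w <+: (a :: u).flatMap σ) : ∃ v s p : Word, v <:+: a :: u ∧
        s.length ≤ 1 ∧ p.length ≤ 1 ∧ w = s ++ (v.flatMap σ ++ p) := by
      obtain ⟨v, p, hv, hp, hw⟩ := exists_prefix_flatMap hσ _ _ h
      exact ⟨v, [], p, hv.isInfix, by simp, hp, hw⟩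
    have of_tail (h : w <:+: u.flatMap σ) : ∃ v s p : Word, v <:+: a :: u ∧
        s.length ≤ 1 ∧ p.length ≤ 1 ∧ w = s ++ (v.flatMap σ ++ p) := by
      obtain ⟨v, s, p, hv, hs, hp, hw⟩ := ih h
      exact ⟨v, s, p, List.infix_cons hv, hs, hp, hw⟩
    rcases hσ a with ⟨x, hx⟩ | ⟨x, y, hx⟩
    · rw [List.flatMap_cons, hx, List.singleton_append, List.infix_cons_iff] at h
      rcases h with h | h
      · exact of_prefix (by simpa [hx] using h)
      · exact of_tail h
    · rw [List.flatMap_cons, hx, List.cons_append, List.singleton_append, List.infix_cons_iff,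
        List.infix_cons_iff] at h
      rcases h with h | h | h
      · exact of_prefix (by simpa [hx] using h)
      · rw [List.prefix_cons_iff] at h
        rcases h with rfl | ⟨t, rfl, ht⟩
        · exact ⟨[], [], [], List.nil_infix, by simp, by simp, rfl⟩
        · obtain ⟨v, p, hv, hp, rfl⟩ := exists_prefix_flatMap hσ _ _ ht
          exact ⟨v, [y], p, List.infix_cons hv.isInfix, by simp, hp, rfl⟩
      · exact of_tail h

/-- The substitution `k ↦ k`, `j ↦ jk` for `j ≠ k`. -/
def appendLetter (k a : Fin 3) : Word := if a = k then [k] else [a, k]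

theorem length_eq_sum_count_s13 (v : Word) :
    v.length = v.count 0 + v.count 1 + v.count 2 := by
  induction v with
  | nil => rfl
  | cons a v ih => fin_cases a <;> simp <;> omega

theorem length_flatMap_appendLetter (k : Fin 3) (v : Word) :
    (v.flatMap (appendLetter k)).length + v.count k = 2 * v.length := by
  induction v with
  | nil => rfl
  | cons a v ih =>
    by_cases h : a = k <;> simp [appendLetter, h] at ih ⊢ <;> omega

theorem count_flatMap_appendLetter (k i : Fin 3) (v : Word) :
    (v.flatMap (appendLetter k)).count i = if i = k then v.length else v.count i := by
  induction v with
  | nil => simp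
  | cons a v ih =>
    rw [List.flatMap_cons, List.count_append, ih]
    grind [appendLetter]

theorem length_flatMap_s4 (v : Word) : (v.flatMap s4).length = 2 * v.length := by
  induction v with
  | nil => rfl
  | cons a v ih =>
    rw [List.flatMap_cons, List.length_append, ih]
    fin_cases a <;> simp [s4] <;> omega

theorem count_flatMap_s4 (i : Fin 3) (v : Word) :
    (v.flatMap s4).count i + v.count i = v.length := by
  induction v with
  | nil => rfl
  | cons a v ih =>
    rw [List.flatMap_cons, List.count_append]
    fin_cases i <;> fin_cases a <;> simp [s4] at ih ⊢ <;> omega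

/-- To balance the image of a word it suffices to compare two factors
`sᵢ ++ σ(vᵢ ++ xᵢ) ++ pᵢ` with `|v₁| = |v₂|`, `x₂` empty and `r₁ = s₁ ++ p₁`, `r₂ = s₂ ++ p₂`. -/
theorem balancedWord_subApply {σ : Fin 3 → Word} {C D : ℝ} {u : Word}
    (hσ : ∀ a, (∃ x, σ a = [x]) ∨ ∃ x y, σ a = [x, y]) (hbal : balancedWord C u)
    (H : ∀ v₁ x v₂ r₁ r₂ : Word, v₁.length = v₂.length → balancedPair C v₁ v₂ →
      r₁.length ≤ 2 → r₂.length ≤ 2 →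
      ((v₁ ++ x).flatMap σ).length + r₁.length = (v₂.flatMap σ).length + r₂.length →
      ∀ i, |(((v₁ ++ x).flatMap σ).count i + r₁.count i : ℝ) -
        ((v₂.flatMap σ).count i + r₂.count i)| ≤ D) :
    balancedWord D (subApply σ u) := by
  intro w₁ w₂ h₁ h₂ hw i
  obtain ⟨v₁, s₁, p₁, hv₁, hs₁, hp₁, rfl⟩ := exists_infix_flatMap hσ _ _ h₁
  obtain ⟨v₂, s₂, p₂, hv₂, hs₂, hp₂, rfl⟩ := exists_infix_flatMap hσ _ _ h₂
  clear h₁ h₂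
  wlog hl : v₂.length ≤ v₁.length generalizing v₁ v₂ s₁ s₂ p₁ p₂
  · rw [abs_sub_comm]
    exact this v₂ s₂ p₂ hv₂ hs₂ hp₂ v₁ s₁ p₁ hv₁ hs₁ hp₁ hw.symm (by omega)
  have ht : (v₁.take v₂.length).length = v₂.length := by simpa using hl
  have key := H (v₁.take v₂.length) (v₁.drop v₂.length) v₂ (s₁ ++ p₁) (s₂ ++ p₂) ht
    (hbal _ _ ((List.take_prefix _ _).isInfix.trans hv₁) hv₂ ht)
    (by rw [List.length_append]; omega) (by rw [List.length_append]; omega)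
    (by rw [List.take_append_drop]; simp only [List.length_append] at hw ⊢; omega) i
  rw [List.take_append_drop] at key
  simp only [List.count_append, Nat.cast_add] at key ⊢
  convert key using 2
  ring

theorem balancedWord_appendLetter (k : Fin 3) {C : ℝ} (hC : 0 ≤ C) {u : Word}
    (hbal : balancedWord C u) : balancedWord (C + 2) (subApply (appendLetter k) u) := by
  refine balancedWord_subApply (fun a => ?_) hbal ?_
  · by_cases h : a = k
    · exact Or.inl ⟨k, by simp [appendLetter, h]⟩
    · exact Or.inr ⟨a, k, by simp [appendLetter, h]⟩
  intro v₁ x v₂ r₁ r₂ hl hb hr₁ hr₂ hlen i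
  have L₁ := length_flatMap_appendLetter k (v₁ ++ x)
  have L₂ := length_flatMap_appendLetter k v₂
  have S₁ := length_eq_sum_count_s13 v₁
  have S₂ := length_eq_sum_count_s13 v₂
  have Sx := length_eq_sum_count_s13 x
  have c₁ : r₁.count i ≤ r₁.length := List.count_le_length
  have c₂ : r₂.count i ≤ r₂.length := List.count_le_length
  have E : (v₁ ++ x).count k + r₂.length = 2 * x.length + v₂.count k + r₁.length := by
    rw [List.length_append] at L₁
    omega
  have xk : x.count k ≤ x.length := List.count_le_length
  have b0 := abs_le.1 (hb 0)
  have b1 := abs_le.1 (hb 1)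
  have b2 := abs_le.1 (hb 2)
  have bk := abs_le.1 (hb k)
  rw [count_flatMap_appendLetter, count_flatMap_appendLetter, abs_le]
  rw [List.count_append] at E
  simp only [List.length_append, List.count_append]
  clear L₁ L₂ hlen
  have n0 : 0 ≤ x.count 0 := Nat.zero_le _
  have n1 : 0 ≤ x.count 1 := Nat.zero_le _
  have n2 : 0 ≤ x.count 2 := Nat.zero_le _
  have m₁ : 0 ≤ r₁.count i := Nat.zero_le _
  have m₂ : 0 ≤ r₂.count i := Nat.zero_le _
  rify at *
  by_cases hik : i = k
  · rw [if_pos hik, if_pos hik]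
    constructor <;> linarith
  · rw [if_neg hik, if_neg hik]
    clear bk xk
    generalize (r₁.count i : ℝ) = q₁ at *
    generalize (r₂.count i : ℝ) = q₂ at *
    fin_cases k <;> fin_cases i <;> first
      | exact absurd rfl hik
      | (simp only [Fin.zero_eta, Fin.mk_one, Fin.reduceFinMk] at E ⊢
         constructor <;> linarith)

theorem balancedWord_s4 {C : ℝ} {u : Word}
    (hbal : balancedWord C u) : balancedWord (C + 2) (subApply s4 u) := by
  refine balancedWord_subApply (fun a => Or.inr ?_) hbal ?_
  · fin_cases a <;> simp [s4]
  intro v₁ x v₂ r₁ r₂ hl hb hr₁ hr₂ hlen i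
  have K₁ := count_flatMap_s4 i (v₁ ++ x)
  have K₂ := count_flatMap_s4 i v₂
  have c₁ : r₁.count i ≤ r₁.length := List.count_le_length
  have c₂ : r₂.count i ≤ r₂.length := List.count_le_length
  have cx : x.count i ≤ x.length := List.count_le_length
  have b := abs_le.1 (hb i)
  rw [length_flatMap_s4, length_flatMap_s4] at hlen
  rw [abs_le]
  rw [List.count_append, List.length_append] at K₁
  rw [List.length_append] at hlen
  have upper : x.length + r₁.count i ≤ x.count i + r₂.count i + 2 := by omega
  have lower : x.count i + r₂.count i ≤ x.length + r₁.count i + 2 := by omega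
  rify at *
  constructor <;> linarith

/-- If u is C-letter balanced then σᵢ(u) is (C+4)-letter balanced for i ∈ {1,2,3},
and σ₄(u) is (C+2)-letter balanced. -/
theorem balanced_word_substitution (C : ℝ) (hC : 0 < C) (u : Word)
    (hbal : balancedWord C u) :
    (∀ σ, (σ = s1 ∨ σ = s2 ∨ σ = s3) → balancedWord (C + 4) (subApply σ u)) ∧
    balancedWord (C + 2) (subApply s4 u) := by
  refine ⟨fun σ hσ => ?_, balancedWord_s4 hbal⟩
  obtain ⟨k, rfl⟩ : ∃ k, σ = appendLetter k := by
    rcases hσ with rfl | rfl | rfl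
    · exact ⟨0, by decide⟩
    · exact ⟨1, by decide⟩
    · exact ⟨2, by decide⟩
  intro v₁ v₂ h₁ h₂ hl i
  linarith [balancedWord_appendLetter k hC.le hbal v₁ v₂ h₁ h₂ hl i]
end

section
/- Let M = M₁·M₂·M₃ = [[4,3,2],[2,2,1],[1,1,1]]. Then for every u ∈ M·ℝ³_{≥0} with u ≠ 0, every v ∈ ᵗM·ℝ³_{≥0} with v ≠ 0, and every x ∈ ℝ³, one has ‖π_{u,v}(x)‖_∞ ≤ (11/7)·‖x‖_∞. In particular, since 𝟏 = (1,1,1) = ᵗM·(0,0,1) lies in ᵗM·ℝ³_{≥0}, also ‖π_{u,𝟏}(x)‖_∞ ≤ (11/7)·‖x‖_∞ for every such u and every x ∈ ℝ³. -/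
open Matrix

noncomputable section

/-- The projection `π_{u,w}(x) = x − (⟨x,w⟩/⟨u,w⟩)·u` onto `w^⊥` along `u`. -/
def projv (u w x : Fin 3 → ℝ) : Fin 3 → ℝ :=
  x - ((∑ i, x i * w i) / (∑ i, u i * w i)) • u

theorem norm_projv_le {u w : Fin 3 → ℝ} {r : ℝ} (hu : ∀ i, 0 ≤ u i) (hw : ∀ i, 0 ≤ w i)
    (hs : 0 < ∑ j, u j * w j)
    (h : ∀ i, u i * (∑ j, w j - 2 * w i) ≤ r * ∑ j, u j * w j) (hr : 0 ≤ 1 + r)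
    (x : Fin 3 → ℝ) : ‖projv u w x‖ ≤ (1 + r) * ‖x‖ := by
  refine (pi_norm_le_iff_of_nonneg (mul_nonneg hr (norm_nonneg x))).2 fun i => ?_
  have hx (j : Fin 3) : |x j| ≤ ‖x‖ := norm_le_pi_norm x j
  have hcoord : projv u w x i =
      (∑ j ∈ Finset.univ.erase i, w j * (x i * u j - u i * x j)) / ∑ j, u j * w j := by
    rw [Finset.sum_erase _ (by ring), eq_div_iff hs.ne']
    simp only [projv, Pi.sub_apply, Pi.smul_apply, smul_eq_mul, sub_mul, mul_sub,
      Finset.sum_sub_distrib]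
    rw [mul_right_comm, div_mul_cancel₀ _ hs.ne', Finset.mul_sum, Finset.sum_mul]
    congr 1 <;> exact Finset.sum_congr rfl fun j _ => by ring
  have hterm (j : Fin 3) : |w j * (x i * u j - u i * x j)| ≤ w j * (u j + u i) * ‖x‖ := by
    rw [abs_mul, abs_of_nonneg (hw j), mul_assoc]
    refine mul_le_mul_of_nonneg_left ((abs_sub _ _).trans ?_) (hw j)
    rw [abs_mul, abs_mul, abs_of_nonneg (hu i), abs_of_nonneg (hu j)]
    nlinarith [mul_le_mul_of_nonneg_right (hx i) (hu j), mul_le_mul_of_nonneg_left (hx j) (hu i)]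
  rw [hcoord, Real.norm_eq_abs, abs_div, abs_of_pos hs, div_le_iff₀ hs]
  calc |∑ j ∈ Finset.univ.erase i, w j * (x i * u j - u i * x j)|
      ≤ ∑ j ∈ Finset.univ.erase i, w j * (u j + u i) * ‖x‖ :=
        (Finset.abs_sum_le_sum_abs _ _).trans (Finset.sum_le_sum fun j _ => hterm j)
    _ = (∑ j, u j * w j + u i * (∑ j, w j - 2 * w i)) * ‖x‖ := by
        rw [Finset.sum_erase_eq_sub (Finset.mem_univ i), ← Finset.sum_mul]
        simp only [mul_add, Finset.sum_add_distrib, ← Finset.sum_mul]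
        simp only [mul_comm (w _) (u _)]
        ring
    _ ≤ (∑ j, u j * w j + r * ∑ j, u j * w j) * ‖x‖ :=
        mul_le_mul_of_nonneg_right (by linarith [h i]) (norm_nonneg x)
    _ = (1 + r) * ‖x‖ * ∑ j, u j * w j := by ring

theorem M1_mul_M2_mul_M3 : M1 * M2 * M3 = !![4, 3, 2; 2, 2, 1; 1, 1, 1] := by
  ext i j
  fin_cases i <;> fin_cases j <;>
    simp [M1, M2, M3, Matrix.mul_apply, Fin.sum_univ_three] <;> norm_num

theorem sum_pos_of_nonneg_of_ne_zero {c : Fin 3 → ℝ} (hc : ∀ i, 0 ≤ c i) (h : c ≠ 0) :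
    0 < c 0 + c 1 + c 2 := by
  rw [← Fin.sum_univ_three]
  exact Fintype.sum_pos (lt_of_le_of_ne hc h.symm)

theorem norm_projv_mulVec_le {c d : Fin 3 → ℝ} (hc : ∀ i, 0 ≤ c i) (hd : ∀ i, 0 ≤ d i)
    (hc0 : c ≠ 0) (hd0 : d ≠ 0) (x : Fin 3 → ℝ) :
    ‖projv ((M1 * M2 * M3).mulVec c) ((M1 * M2 * M3)ᵀ.mulVec d) x‖ ≤ 11 / 7 * ‖x‖ := by
  have hu : (M1 * M2 * M3).mulVec c =
      ![4 * c 0 + 3 * c 1 + 2 * c 2, 2 * c 0 + 2 * c 1 + c 2, c 0 + c 1 + c 2] := by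
    ext i
    fin_cases i <;> simp [M1_mul_M2_mul_M3, Matrix.mulVec, dotProduct, Fin.sum_univ_three]
  have hv : (M1 * M2 * M3)ᵀ.mulVec d =
      ![4 * d 0 + 2 * d 1 + d 2, 3 * d 0 + 2 * d 1 + d 2, 2 * d 0 + d 1 + d 2] := by
    ext i
    fin_cases i <;> simp [M1_mul_M2_mul_M3, Matrix.mulVec, dotProduct, Fin.sum_univ_three]
  have hcd (i j : Fin 3) : 0 ≤ c i * d j := mul_nonneg (hc i) (hd j)
  have hpos := mul_pos (sum_pos_of_nonneg_of_ne_zero hc hc0) (sum_pos_of_nonneg_of_ne_zero hd hd0)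
  rw [hu, hv, show (11 / 7 : ℝ) = 1 + 4 / 7 by norm_num]
  refine norm_projv_le ?_ ?_ ?_ ?_ (by norm_num) x
  · intro i
    fin_cases i <;> simp <;> linarith [hc 0, hc 1, hc 2]
  · intro i
    fin_cases i <;> simp <;> linarith [hd 0, hd 1, hd 2]
  · simp only [Fin.sum_univ_three, Matrix.cons_val]
    nlinarith only [hpos, hcd 0 0, hcd 0 1, hcd 0 2, hcd 1 0, hcd 1 1, hcd 1 2, hcd 2 0, hcd 2 1,
      hcd 2 2]
  · intro i
    fin_cases i <;> simp [Fin.sum_univ_three] <;>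
      linarith only [hcd 0 0, hcd 0 1, hcd 0 2, hcd 1 0, hcd 1 1, hcd 1 2, hcd 2 0, hcd 2 1,
        hcd 2 2]

/-- With M = M₁M₂M₃, for every nonzero u in the cone M·ℝ³₊ and nonzero v in the cone
ᵗM·ℝ³₊ one has ‖π_{u,v}(x)‖_∞ ≤ (11/7)‖x‖_∞ for all x; in particular (since
𝟏 ∈ ᵗM·ℝ³₊) also ‖π_{u,𝟏}(x)‖_∞ ≤ (11/7)‖x‖_∞.  (Here the norm on `Fin 3 → ℝ`
is the max norm.) -/
theorem projection_norm_bound :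
    ∀ u : Fin 3 → ℝ, u ≠ 0 →
      (∃ c : Fin 3 → ℝ, (∀ i, 0 ≤ c i) ∧ u = (M1 * M2 * M3).mulVec c) →
      ((∀ v : Fin 3 → ℝ, v ≠ 0 →
          (∃ c : Fin 3 → ℝ, (∀ i, 0 ≤ c i) ∧ v = (M1 * M2 * M3)ᵀ.mulVec c) →
          ∀ x : Fin 3 → ℝ, ‖projv u v x‖ ≤ 11 / 7 * ‖x‖) ∧
        ∀ x : Fin 3 → ℝ, ‖projv u (fun _ => 1) x‖ ≤ 11 / 7 * ‖x‖) := by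
  rintro _ hu ⟨c, hc, rfl⟩
  have hc0 : c ≠ 0 := by
    rintro rfl
    exact hu (Matrix.mulVec_zero _)
  refine ⟨?_, fun x => ?_⟩
  · rintro _ hv ⟨d, hd, rfl⟩ x
    refine norm_projv_mulVec_le hc hd hc0 ?_ x
    rintro rfl
    exact hv (Matrix.mulVec_zero _)
  · have hone : (fun _ => 1 : Fin 3 → ℝ) = (M1 * M2 * M3)ᵀ.mulVec (Pi.single 2 1) := by
      ext i
      fin_cases i <;> simp [M1_mul_M2_mul_M3]
    rw [hone]
    have hnonneg : (0 : Fin 3 → ℝ) ≤ Pi.single 2 1 := Pi.single_nonneg.2 zero_le_one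
    exact norm_projv_mulVec_le hc hnonneg hc0 (by simp) x

end
end

section
/- Let (aₙ) ∈ {1,2,3,4}^ℕ admit a generalized right eigenvector u. For 0 ≤ k ≤ ℓ put P_{[k,ℓ)} = M_{a_k}···M_{a_{ℓ−1}} and 𝟏_k = ᵗP_{[0,k)}·𝟏. Let 0 ≤ m ≤ n be such that (i) m = 0, or m ≥ 3 and P_{[m−3,m+3)} = (M₁M₂M₃)², and (ii) n = m, or n ≥ 3 and P_{[n−3,n+3)} = (M₁M₂M₃)². Then for every x ∈ ℝ³ with ⟨x, 𝟏_n⟩ = 0, one has ‖P_{[m,n)}·x‖_∞ ≤ 10·‖x‖_∞. -/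
open Matrix

noncomputable section

/-- `Pprod a k l = M_{a_k} ⋯ M_{a_{l-1}}` (the identity if `l ≤ k`). -/
def Pprod (a : ℕ → Fin 4) (k l : ℕ) : Matrix (Fin 3) (Fin 3) ℝ :=
  (List.ofFn fun j : Fin (l - k) => Mat (a (k + j))).prod

/-- `u` is a generalized right eigenvector of the sequence of matrices `(M_{aₙ})`:
u is nonzero, nonnegative, and `⋂ₙ M_{a₀}⋯M_{a_{n-1}}·ℝ³₊ = ℝ₊·u`. -/
def genRightEV (a : ℕ → Fin 4) (u : Fin 3 → ℝ) : Prop :=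
  u ≠ 0 ∧ (∀ i, 0 ≤ u i) ∧
    (⋂ n : ℕ, (Pprod a 0 n).mulVec '' {v : Fin 3 → ℝ | ∀ i, 0 ≤ v i})
      = {w : Fin 3 → ℝ | ∃ c : ℝ, 0 ≤ c ∧ w = c • u}

theorem Pprod_eq_range (a : ℕ → Fin 4) (k l : ℕ) :
    Pprod a k l = ((List.range (l - k)).map fun j => Mat (a (k + j))).prod := by
  unfold Pprod
  congr 1
  apply List.ext_getElem <;> simp

theorem Pprod_self (a : ℕ → Fin 4) (k : ℕ) : Pprod a k k = 1 := by
  simp [Pprod_eq_range]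

theorem Pprod_mul_Pprod (a : ℕ → Fin 4) {k l n : ℕ} (hkl : k ≤ l) (hln : l ≤ n) :
    Pprod a k l * Pprod a l n = Pprod a k n := by
  obtain ⟨d, rfl⟩ := Nat.exists_eq_add_of_le hkl
  obtain ⟨e, rfl⟩ := Nat.exists_eq_add_of_le hln
  have h : k + d + e - k = d + e := by omega
  rw [Pprod_eq_range, Pprod_eq_range, Pprod_eq_range, h, Nat.add_sub_cancel_left,
    Nat.add_sub_cancel_left, List.range_add]
  simp [Function.comp_def, add_assoc]

theorem Pprod_succ_self (a : ℕ → Fin 4) (k : ℕ) : Pprod a k (k + 1) = Mat (a k) := by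
  simp [Pprod_eq_range]

theorem Pprod_succ (a : ℕ → Fin 4) {k l : ℕ} (hkl : k ≤ l) :
    Pprod a k (l + 1) = Pprod a k l * Mat (a l) := by
  rw [← Pprod_mul_Pprod a hkl (Nat.le_succ l), Pprod_succ_self]

theorem Mat_mulVec_pos (c : Fin 4) {v : Fin 3 → ℝ} (hv : ∀ i, 0 < v i) :
    ∀ i, 0 < (Mat c *ᵥ v) i := by
  have h0 := hv 0
  have h1 := hv 1
  have h2 := hv 2
  intro i
  fin_cases c <;> fin_cases i <;>
    simp [Mat, M1, M2, M3, M4, Matrix.mulVec, dotProduct, Fin.sum_univ_three] <;> linarith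

theorem Mat_transpose_mulVec_pos (c : Fin 4) {v : Fin 3 → ℝ} (hv : ∀ i, 0 < v i) :
    ∀ i, 0 < ((Mat c)ᵀ *ᵥ v) i := by
  have h0 := hv 0
  have h1 := hv 1
  have h2 := hv 2
  intro i
  fin_cases c <;> fin_cases i <;>
    simp [Mat, M1, M2, M3, M4, Matrix.mulVec, dotProduct, Fin.sum_univ_three] <;> linarith

theorem Pprod_mulVec_pos (a : ℕ → Fin 4) {k l : ℕ} (hkl : k ≤ l) {v : Fin 3 → ℝ}
    (hv : ∀ i, 0 < v i) : ∀ i, 0 < (Pprod a k l *ᵥ v) i := by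
  induction l, hkl using Nat.le_induction generalizing v with
  | base => simpa [Pprod_self] using hv
  | succ l hkl ih =>
    rw [Pprod_succ a hkl, ← Matrix.mulVec_mulVec]
    exact ih (Mat_mulVec_pos _ hv)

theorem Pprod_transpose_mulVec_pos (a : ℕ → Fin 4) {k l : ℕ} (hkl : k ≤ l) {v : Fin 3 → ℝ}
    (hv : ∀ i, 0 < v i) : ∀ i, 0 < ((Pprod a k l)ᵀ *ᵥ v) i := by
  induction l, hkl using Nat.le_induction with
  | base => simpa [Pprod_self] using hv
  | succ l hkl ih =>
    rw [Pprod_succ a hkl, Matrix.transpose_mul, ← Matrix.mulVec_mulVec]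
    exact Mat_transpose_mulVec_pos _ ih

/-- A vector orthogonal to a positive vector has its entries bounded by its oscillation. -/
theorem abs_le_of_orthogonal_pos {y u : Fin 3 → ℝ} {D : ℝ} (hu : ∀ i, 0 < u i)
    (hyu : y ⬝ᵥ u = 0) (hy : ∀ i j, y i - y j ≤ D) (i : Fin 3) : |y i| ≤ D := by
  rw [abs_le]
  constructor
  · by_contra! h
    have : y ⬝ᵥ u < 0 := Finset.sum_neg
      (fun j _ => mul_neg_of_neg_of_pos (by linarith [hy j i]) (hu j)) Finset.univ_nonempty
    exact this.ne hyu
  · by_contra! h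
    have : 0 < y ⬝ᵥ u := Finset.sum_pos
      (fun j _ => mul_pos (by linarith [hy i j]) (hu j)) Finset.univ_nonempty
    exact this.ne' hyu

theorem Mat_transpose_oscillation_le (c : Fin 4) {y u : Fin 3 → ℝ} {D : ℝ}
    (hu : ∀ i, 0 < u i) (hyu : y ⬝ᵥ u = 0) (hy : ∀ i j, y i - y j ≤ D) :
    ∀ i j, ((Mat c)ᵀ *ᵥ y) i - ((Mat c)ᵀ *ᵥ y) j ≤ D := by
  have hb := fun i => abs_le.1 (abs_le_of_orthogonal_pos hu hyu hy i)
  have b0 := hb 0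
  have b1 := hb 1
  have b2 := hb 2
  have h01 := hy 0 1
  have h02 := hy 0 2
  have h12 := hy 1 2
  have h10 := hy 1 0
  have h20 := hy 2 0
  have h21 := hy 2 1
  intro i j
  fin_cases c <;> fin_cases i <;> fin_cases j <;>
    simp [Mat, M1, M2, M3, M4, Matrix.mulVec, dotProduct, Fin.sum_univ_three] <;> linarith

theorem Pprod_transpose_oscillation_le (a : ℕ → Fin 4) {k l : ℕ} (hkl : k ≤ l)
    {y z : Fin 3 → ℝ} {D : ℝ} (hz : ∀ i, 0 < z i) (hyz : y ⬝ᵥ (Pprod a k l *ᵥ z) = 0)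
    (hy : ∀ i j, y i - y j ≤ D) :
    ∀ i j, ((Pprod a k l)ᵀ *ᵥ y) i - ((Pprod a k l)ᵀ *ᵥ y) j ≤ D := by
  induction l, hkl using Nat.le_induction generalizing z with
  | base => simpa [Pprod_self] using hy
  | succ l hkl ih =>
    rw [Pprod_succ a hkl, ← Matrix.mulVec_mulVec] at hyz
    rw [Pprod_succ a hkl, Matrix.transpose_mul, ← Matrix.mulVec_mulVec]
    refine Mat_transpose_oscillation_le _ (Mat_mulVec_pos (a l) hz) ?_
      (ih (Mat_mulVec_pos _ hz) hyz)
    rw [Matrix.mulVec_transpose, ← Matrix.dotProduct_mulVec, hyz]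

/-- A factorization of `(M1 * M2 * M3) ^ 2` acting on `𝟏` has its first three letters forced. -/
theorem Mat_eq_of_mulVec_eq {p q r : Fin 4} {v : Fin 3 → ℝ} (hv : ∀ i, 0 < v i)
    (h : Mat p *ᵥ (Mat q *ᵥ (Mat r *ᵥ v)) = ((M1 * M2 * M3) ^ 2) *ᵥ fun _ => 1) :
    p = 0 ∧ q = 1 ∧ r = 2 := by
  have hr := Mat_mulVec_pos r hv
  have hq := Mat_mulVec_pos q hr
  have hQ : ((M1 * M2 * M3) ^ 2) *ᵥ (fun _ => 1) = ![57, 31, 17] := by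
    rw [pow_two, M1_mul_M2_mul_M3, ← Matrix.mulVec_mulVec]
    ext i
    fin_cases i <;> simp [Matrix.mulVec, dotProduct, Fin.sum_univ_three] <;> norm_num
  rw [hQ] at h
  have hp : p = 0 := by
    generalize Mat q *ᵥ (Mat r *ᵥ v) = s at h hq
    have e0 := congrFun h 0
    have e1 := congrFun h 1
    have e2 := congrFun h 2
    have := hq 0
    have := hq 1
    have := hq 2
    fin_cases p <;>
      simp [Mat, M1, M2, M3, M4, Matrix.mulVec, dotProduct, Fin.sum_univ_three] at e0 e1 e2 ⊢ <;>
      linarith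
  subst hp
  have hs : Mat q *ᵥ (Mat r *ᵥ v) = ![9, 31, 17] := by
    generalize Mat q *ᵥ (Mat r *ᵥ v) = s at h
    have e0 := congrFun h 0
    have e1 := congrFun h 1
    have e2 := congrFun h 2
    ext i
    fin_cases i <;>
      simp [Mat, M1, Matrix.mulVec, dotProduct, Fin.sum_univ_three] at e0 e1 e2 ⊢ <;>
      linarith
  have hq' : q = 1 := by
    generalize Mat r *ᵥ v = s at hs hr
    have e0 := congrFun hs 0
    have e1 := congrFun hs 1
    have e2 := congrFun hs 2
    have := hr 0
    have := hr 1
    have := hr 2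
    fin_cases q <;>
      simp [Mat, M1, M2, M3, M4, Matrix.mulVec, dotProduct, Fin.sum_univ_three] at e0 e1 e2 ⊢ <;>
      linarith
  subst hq'
  refine ⟨rfl, rfl, ?_⟩
  have ht : Mat r *ᵥ v = ![9, 5, 17] := by
    generalize Mat r *ᵥ v = s at hs
    have e0 := congrFun hs 0
    have e1 := congrFun hs 1
    have e2 := congrFun hs 2
    ext i
    fin_cases i <;>
      simp [Mat, M2, Matrix.mulVec, dotProduct, Fin.sum_univ_three] at e0 e1 e2 ⊢ <;>
      linarith
  have e0 := congrFun ht 0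
  have e1 := congrFun ht 1
  have e2 := congrFun ht 2
  have := hv 0
  have := hv 1
  have := hv 2
  fin_cases r <;>
    simp [Mat, M1, M2, M3, M4, Matrix.mulVec, dotProduct, Fin.sum_univ_three] at e0 e1 e2 ⊢ <;>
    linarith

theorem Pprod_three_eq (a : ℕ → Fin 4) (k : ℕ)
    (h : Pprod a k (k + 6) = (M1 * M2 * M3) ^ 2) : Pprod a k (k + 3) = M1 * M2 * M3 := by
  have h3 : Pprod a k (k + 3) = Mat (a k) * Mat (a (k + 1)) * Mat (a (k + 2)) := by
    rw [Pprod_succ a (by omega), Pprod_succ a (by omega), Pprod_succ_self]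
  rw [← Pprod_mul_Pprod a (by omega : k ≤ k + 3) (by omega), h3] at h
  have hv := Pprod_mulVec_pos a (by omega : k + 3 ≤ k + 6) (v := fun _ => 1)
    (fun _ => one_pos)
  obtain ⟨e0, e1, e2⟩ := Mat_eq_of_mulVec_eq (p := a k) (q := a (k + 1)) (r := a (k + 2)) hv (by
    rw [← h]
    simp only [Matrix.mulVec_mulVec, Matrix.mul_assoc])
  rw [h3, e0, e1, e2]
  rfl

theorem transpose_mulVec_sub_le {v : Fin 3 → ℝ} (hv : ∀ i, 0 < v i) (i j k : Fin 3) :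
    ((M1 * M2 * M3)ᵀ *ᵥ v) k - ((M1 * M2 * M3)ᵀ *ᵥ v) j ≤ ((M1 * M2 * M3)ᵀ *ᵥ v) i := by
  have h0 := hv 0
  have h1 := hv 1
  have h2 := hv 2
  have hQ : (M1 * M2 * M3)ᵀ *ᵥ v =
      ![4 * v 0 + 2 * v 1 + v 2, 3 * v 0 + 2 * v 1 + v 2, 2 * v 0 + v 1 + v 2] := by
    rw [M1_mul_M2_mul_M3]
    ext i
    fin_cases i <;> simp [Matrix.mulVec, dotProduct, Fin.sum_univ_three]
  rw [hQ]
  fin_cases i <;> fin_cases j <;> fin_cases k <;> simp <;> linarith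

theorem norm_Pprod_mulVec_le (a : ℕ → Fin 4) {m n : ℕ} (hmn : m ≤ n) {w x : Fin 3 → ℝ}
    (hw : ∀ i, 0 < w i) (hosc : ∀ i j k, w k - w j ≤ w i)
    (hx : w ⬝ᵥ (Pprod a m n *ᵥ x) = 0) : ‖Pprod a m n *ᵥ x‖ ≤ 6 * ‖x‖ := by
  have hz : ∀ _ : Fin 3, (0 : ℝ) < 1 := fun _ => one_pos
  have hu := Pprod_mulVec_pos a hmn hz
  set u := Pprod a m n *ᵥ fun _ => 1 with hu_def
  rw [pi_norm_le_iff_of_nonneg (by positivity)]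
  intro i
  have hS : 0 < w ⬝ᵥ u :=
    Finset.sum_pos (fun j _ => mul_pos (hw j) (hu j)) Finset.univ_nonempty
  set c := u i / (w ⬝ᵥ u) with hc_def
  have hc : 0 ≤ c := div_nonneg (hu i).le hS.le
  have hcw : c * w i ≤ 1 := by
    rw [hc_def, div_mul_eq_mul_div, div_le_one hS, mul_comm]
    exact Finset.single_le_sum (f := fun j => w j * u j)
      (fun j _ => (mul_pos (hw j) (hu j)).le) (Finset.mem_univ i)
  set y : Fin 3 → ℝ := Pi.single i 1 - c • w with hy_def
  have hyu : y ⬝ᵥ u = 0 := by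
    rw [hy_def, sub_dotProduct, smul_dotProduct, single_dotProduct, smul_eq_mul, hc_def,
      div_mul_cancel₀ _ hS.ne', one_mul, sub_self]
  have hy : ∀ j k, y j - y k ≤ 2 := by
    intro j k
    have h1 : (Pi.single i 1 : Fin 3 → ℝ) j ≤ 1 := by
      rw [Pi.single_apply]; split_ifs <;> norm_num
    have h2 : 0 ≤ (Pi.single i 1 : Fin 3 → ℝ) k := by
      rw [Pi.single_apply]; split_ifs <;> norm_num
    have h3 := mul_le_mul_of_nonneg_left (hosc i j k) hc
    simp only [hy_def, Pi.sub_apply, Pi.smul_apply, smul_eq_mul]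
    linarith
  have hosc' := Pprod_transpose_oscillation_le a hmn hz hyu hy
  have hb := abs_le_of_orthogonal_pos hz (y := (Pprod a m n)ᵀ *ᵥ y) (by
    rw [Matrix.mulVec_transpose, ← Matrix.dotProduct_mulVec, ← hu_def, hyu]) hosc'
  have hi : (Pprod a m n *ᵥ x) i = ((Pprod a m n)ᵀ *ᵥ y) ⬝ᵥ x := by
    rw [Matrix.mulVec_transpose, ← Matrix.dotProduct_mulVec, hy_def, sub_dotProduct,
      smul_dotProduct, hx, single_dotProduct]
    simp
  rw [hi, Real.norm_eq_abs]
  calc |((Pprod a m n)ᵀ *ᵥ y) ⬝ᵥ x|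
      ≤ ∑ j, |((Pprod a m n)ᵀ *ᵥ y) j * x j| := Finset.abs_sum_le_sum_abs _ _
    _ ≤ ∑ _j : Fin 3, 2 * ‖x‖ := Finset.sum_le_sum fun j _ => by
        rw [abs_mul]
        exact mul_le_mul (hb j) (norm_le_pi_norm x j) (abs_nonneg _) zero_le_two
    _ = 6 * ‖x‖ := by simp; ring

/-- If (aₙ) admits a generalized right eigenvector, m ≤ n, m is 0 or sits at the end
of a block `P_{[m-3,m+3)} = (M₁M₂M₃)²`, and similarly n = m or
`P_{[n-3,n+3)} = (M₁M₂M₃)²`, then `‖P_{[m,n)}·x‖_∞ ≤ 10‖x‖_∞` for every x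
orthogonal to `𝟏_n = ᵗP_{[0,n)}·𝟏`. -/
theorem operator_norm_bound_on_hyperplane (a : ℕ → Fin 4) (u : Fin 3 → ℝ)
    (hu : genRightEV a u) (m n : ℕ) (hmn : m ≤ n)
    (hm : m = 0 ∨ (3 ≤ m ∧ Pprod a (m - 3) (m + 3) = (M1 * M2 * M3) ^ 2))
    (hn : n = m ∨ (3 ≤ n ∧ Pprod a (n - 3) (n + 3) = (M1 * M2 * M3) ^ 2)) :
    ∀ x : Fin 3 → ℝ,
      (∑ i, x i * ((Pprod a 0 n)ᵀ.mulVec (fun _ => 1)) i) = 0 →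
      ‖(Pprod a m n).mulVec x‖ ≤ 10 * ‖x‖ := by
  intro x hx
  have h1 : Pprod a 0 n = Pprod a 0 m * Pprod a m n :=
    (Pprod_mul_Pprod a (Nat.zero_le m) hmn).symm
  have hx' : ((Pprod a 0 m)ᵀ *ᵥ fun _ => 1) ⬝ᵥ (Pprod a m n *ᵥ x) = 0 := by
    rw [Matrix.dotProduct_mulVec, ← Matrix.mulVec_transpose, Matrix.mulVec_mulVec,
      ← Matrix.transpose_mul, ← h1, dotProduct_comm]
    exact hx
  have hosc : ∀ i j k, ((Pprod a 0 m)ᵀ *ᵥ fun _ => 1) k - ((Pprod a 0 m)ᵀ *ᵥ fun _ => 1) j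
      ≤ ((Pprod a 0 m)ᵀ *ᵥ fun _ => 1) i := by
    rcases hm with rfl | ⟨h3, hm⟩
    · simp [Pprod_self]
    · obtain ⟨k, rfl⟩ := Nat.exists_eq_add_of_le' h3
      rw [Nat.add_sub_cancel] at hm
      rw [← Pprod_mul_Pprod a (Nat.zero_le k) (Nat.le_add_right k 3), Pprod_three_eq a k hm,
        Matrix.transpose_mul, ← Matrix.mulVec_mulVec]
      exact transpose_mulVec_sub_le
        (Pprod_transpose_mulVec_pos a (Nat.zero_le k) fun _ => one_pos)
  have := norm_Pprod_mulVec_le a hmn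
    (Pprod_transpose_mulVec_pos a (Nat.zero_le m) fun _ => one_pos) hosc hx'
  linarith [norm_nonneg x]

end
end

section
/- For all real x₁, x₂ with 0 < x₂ < x₁ < 1, ∫_{Δ'^#} (1 + x₁y₁ + x₂y₂)^{−3} dy₁ dy₂ = 1/((1+x₁)(1+x₂)(x₁+x₂)), where Δ'^# = {(y₁,y₂) ∈ ℝ² : y₁ > 0, y₂ > 0, y₁ + y₂ ≥ 1, |y₁ − y₂| ≤ 1} and the integral is with respect to 2-dimensional Lebesgue measure. -/
open MeasureTheory

open Set Filter Topology

/-- An antiderivative of `(a + b * y) ^ (-2)`. -/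
theorem hasDerivAt_neg_inv_affine {a b y : ℝ} (hb : b ≠ 0) (h : a + b * y ≠ 0) :
    HasDerivAt (fun y => -(b * (a + b * y))⁻¹) ((a + b * y) ^ (-2 : ℤ)) y := by
  have h0 : HasDerivAt (fun y => b * (a + b * y)) (b * b) y := by
    simpa using (((hasDerivAt_id y).const_mul b).const_add a).const_mul b
  refine (h0.inv (mul_ne_zero hb h)).neg.congr_deriv ?_
  rw [zpow_neg]
  norm_cast
  field_simp

/-- An antiderivative of `(a + b * y) ^ (-3)`. -/
theorem hasDerivAt_neg_inv_affine_sq {a b y : ℝ} (hb : b ≠ 0) (h : a + b * y ≠ 0) :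
    HasDerivAt (fun y => -(2 * b * (a + b * y) ^ 2)⁻¹) ((a + b * y) ^ (-3 : ℤ)) y := by
  have h0 : HasDerivAt (fun y => 2 * b * (a + b * y) ^ 2) (2 * b * (2 * (a + b * y) * b)) y := by
    simpa using ((((hasDerivAt_id y).const_mul b).const_add a).pow 2).const_mul (2 * b)
  refine (h0.inv (mul_ne_zero (mul_ne_zero two_ne_zero hb) (pow_ne_zero 2 h))).neg.congr_deriv ?_
  rw [zpow_neg]
  norm_cast
  field_simp

theorem tendsto_neg_inv_affine {a b : ℝ} (hb : 0 < b) :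
    Tendsto (fun y => -(b * (a + b * y))⁻¹) atTop (𝓝 0) := by
  rw [← neg_zero]
  exact (tendsto_inv_atTop_zero.comp ((tendsto_atTop_add_const_left _ a
    (tendsto_id.const_mul_atTop hb)).const_mul_atTop hb)).neg

theorem integrableOn_Ioi_affine_zpow_neg_two {a b t : ℝ} (hb : 0 < b) (h : 0 < a + b * t) :
    IntegrableOn (fun y => (a + b * y) ^ (-2 : ℤ)) (Ioi t) := by
  have hpos : ∀ y ∈ Ici t, 0 < a + b * y := fun y hy => by
    have := mul_le_mul_of_nonneg_left (mem_Ici.1 hy) hb.le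
    linarith
  exact integrableOn_Ioi_deriv_of_nonneg'
    (fun y hy => hasDerivAt_neg_inv_affine hb.ne' (hpos y hy).ne')
    (fun y hy => (zpow_pos (hpos y (Ioi_subset_Ici_self hy)) _).le)
    (tendsto_neg_inv_affine hb)

theorem integral_Ioi_affine_zpow_neg_two {a b t : ℝ} (hb : 0 < b) (h : 0 < a + b * t) :
    ∫ y in Ioi t, (a + b * y) ^ (-2 : ℤ) = (b * (a + b * t))⁻¹ := by
  have hpos : ∀ y ∈ Ici t, 0 < a + b * y := fun y hy => by
    have := mul_le_mul_of_nonneg_left (mem_Ici.1 hy) hb.le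
    linarith
  rw [integral_Ioi_of_hasDerivAt_of_tendsto'
    (fun y hy => hasDerivAt_neg_inv_affine hb.ne' (hpos y hy).ne')
    (integrableOn_Ioi_affine_zpow_neg_two hb h) (tendsto_neg_inv_affine hb)]
  ring

theorem continuousOn_affine_zpow {a b : ℝ} (n : ℤ) {s : Set ℝ} (h : ∀ y ∈ s, 0 < a + b * y) :
    ContinuousOn (fun y => (a + b * y) ^ n) s :=
  ContinuousOn.zpow₀ (by fun_prop) n fun y hy => Or.inl (h y hy).ne'

theorem integral_Icc_affine_zpow_neg_three {a b s t : ℝ} (hst : s ≤ t) (hb : 0 < b)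
    (h : 0 < a + b * s) :
    ∫ y in Icc s t, (a + b * y) ^ (-3 : ℤ) =
      (2 * b)⁻¹ * ((a + b * s) ^ (-2 : ℤ) - (a + b * t) ^ (-2 : ℤ)) := by
  have hpos : ∀ y ∈ Icc s t, 0 < a + b * y := fun y hy => by
    have := mul_le_mul_of_nonneg_left hy.1 hb.le
    linarith
  rw [integral_Icc_eq_integral_Ioc, ← intervalIntegral.integral_of_le hst,
    intervalIntegral.integral_eq_sub_of_hasDerivAt
      (f := fun y => -(2 * b * (a + b * y) ^ 2)⁻¹)
      (fun y hy => hasDerivAt_neg_inv_affine_sq hb.ne' (hpos y (uIcc_of_le hst ▸ hy)).ne')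
      (ContinuousOn.intervalIntegrable (by
        rw [uIcc_of_le hst]; exact continuousOn_affine_zpow _ hpos))]
  have h1 := hpos s (left_mem_Icc.2 hst)
  have h2 := hpos t (right_mem_Icc.2 hst)
  simp only [zpow_neg]
  norm_cast
  field_simp
  ring

/-- The integral of the density over a vertical slice of the dual domain, as a function of the
abscissa, is integrable with the expected value. -/
theorem integrableOn_slice_and_integral (x1 x2 : ℝ) (h1 : 0 < x2) (h2 : x2 < x1) (h3 : x1 < 1) :
    IntegrableOn (fun x => (2 * x2)⁻¹ * ((1 + x1 * x + x2 * |1 - x|) ^ (-2 : ℤ) -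
      (1 + x1 * x + x2 * (1 + x)) ^ (-2 : ℤ))) (Ioi 0) ∧
    ∫ x in Ioi (0 : ℝ), (2 * x2)⁻¹ * ((1 + x1 * x + x2 * |1 - x|) ^ (-2 : ℤ) -
      (1 + x1 * x + x2 * (1 + x)) ^ (-2 : ℤ)) = 1 / ((1 + x1) * (1 + x2) * (x1 + x2)) := by
  have eqC : (fun x : ℝ => (1 + x1 * x + x2 * (1 + x)) ^ (-2 : ℤ)) =
      fun x => ((1 + x2) + (x1 + x2) * x) ^ (-2 : ℤ) := by
    funext x; congr 1; ring
  have eqA : EqOn (fun x : ℝ => ((1 + x2) + (x1 - x2) * x) ^ (-2 : ℤ))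
      (fun x => (1 + x1 * x + x2 * |1 - x|) ^ (-2 : ℤ)) (Ioc 0 1) := by
    intro x hx
    have : |1 - x| = 1 - x := abs_of_nonneg (by linarith [hx.2])
    simp only [this]; congr 1; ring
  have eqB : EqOn (fun x : ℝ => ((1 - x2) + (x1 + x2) * x) ^ (-2 : ℤ))
      (fun x => (1 + x1 * x + x2 * |1 - x|) ^ (-2 : ℤ)) (Ioi 1) := by
    intro x hx
    have : |1 - x| = x - 1 := by
      rw [abs_of_nonpos (by linarith [mem_Ioi.1 hx])]; ring
    simp only [this]; congr 1; ring
  have hs : 0 < x1 + x2 := by linarith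
  have hd : 0 < x1 - x2 := by linarith
  have hC0 : 0 < (1 + x2) + (x1 + x2) * 0 := by linarith
  have hB0 : 0 < (1 - x2) + (x1 + x2) * 1 := by linarith
  have hA0 : 0 < (1 + x2) + (x1 - x2) * 0 := by linarith
  have hA1 : 0 < (1 + x2) + (x1 - x2) * 1 := by linarith
  have iC := integrableOn_Ioi_affine_zpow_neg_two hs hC0
  have iA' := integrableOn_Ioi_affine_zpow_neg_two hd hA0
  have iA := (iA'.mono_set Ioc_subset_Ioi_self : IntegrableOn _ (Ioc (0 : ℝ) 1) volume).congr_fun eqA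
    measurableSet_Ioc
  have iB := (integrableOn_Ioi_affine_zpow_neg_two hs hB0).congr_fun eqB measurableSet_Ioi
  have hU : Ioc (0 : ℝ) 1 ∪ Ioi 1 = Ioi 0 := Ioc_union_Ioi_eq_Ioi zero_le_one
  have iAB := hU ▸ iA.union iB
  rw [← eqC] at iC
  have vC := integral_Ioi_affine_zpow_neg_two hs hC0
  have vB := integral_Ioi_affine_zpow_neg_two hs hB0
  have vA : ∫ x in Ioc (0 : ℝ) 1, ((1 + x2) + (x1 - x2) * x) ^ (-2 : ℤ) =
      ((x1 - x2) * ((1 + x2) + (x1 - x2) * 0))⁻¹ - ((x1 - x2) * ((1 + x2) + (x1 - x2) * 1))⁻¹ := by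
    rw [← integral_Ioi_affine_zpow_neg_two hd hA0, ← integral_Ioi_affine_zpow_neg_two hd hA1,
      ← hU, setIntegral_union (Ioc_disjoint_Ioi le_rfl) measurableSet_Ioi
        (iA'.mono_set Ioc_subset_Ioi_self) (integrableOn_Ioi_affine_zpow_neg_two hd hA1)]
    ring
  refine ⟨(iAB.sub iC).const_mul _, ?_⟩
  rw [integral_const_mul, integral_sub iAB iC, eqC, vC, ← hU,
    setIntegral_union (Ioc_disjoint_Ioi le_rfl) measurableSet_Ioi iA iB,
    ← setIntegral_congr_fun measurableSet_Ioc eqA, ← setIntegral_congr_fun measurableSet_Ioi eqB,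
    vA, vB]
  have e1 : (1 + x2) + (x1 - x2) * 1 = 1 + x1 := by ring
  have e2 : (1 - x2) + (x1 + x2) * 1 = 1 + x1 := by ring
  rw [e1, e2]
  simp only [mul_zero, add_zero]
  have : 0 < 1 + x1 := by linarith
  have : 0 < 1 + x2 := by linarith
  field_simp
  ring

theorem dual_domain_slice {x : ℝ} (hx : x ≠ 1) (hx0 : 0 < x) (y : ℝ) :
    (0 < x ∧ 0 < y ∧ 1 ≤ x + y ∧ |x - y| ≤ 1) ↔ y ∈ Icc |1 - x| (1 + x) := by
  rw [mem_Icc, abs_le, abs_le]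
  constructor
  · rintro ⟨-, hy, h, h', h''⟩
    exact ⟨⟨by linarith, by linarith⟩, by linarith⟩
  · rintro ⟨⟨h, h'⟩, h''⟩
    refine ⟨hx0, ?_, by linarith, by linarith, by linarith⟩
    rcases lt_or_gt_of_ne hx with h | h <;> linarith

/-- The dual-density identity for the sorted Reverse algorithm:
∫_{Δ'^#} (1 + x₁y₁ + x₂y₂)⁻³ dy = 1/((1+x₁)(1+x₂)(x₁+x₂)) for 0 < x₂ < x₁ < 1,
where Δ'^# = {y : y₁,y₂ > 0, y₁+y₂ ≥ 1, |y₁−y₂| ≤ 1}. -/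
theorem dual_density_integral (x1 x2 : ℝ) (h1 : 0 < x2) (h2 : x2 < x1) (h3 : x1 < 1) :
    (∫ y in {p : ℝ × ℝ | 0 < p.1 ∧ 0 < p.2 ∧ 1 ≤ p.1 + p.2 ∧ |p.1 - p.2| ≤ 1},
        (1 + x1 * y.1 + x2 * y.2) ^ (-3 : ℤ))
      = 1 / ((1 + x1) * (1 + x2) * (x1 + x2)) := by
  set S : Set (ℝ × ℝ) := {p | 0 < p.1 ∧ 0 < p.2 ∧ 1 ≤ p.1 + p.2 ∧ |p.1 - p.2| ≤ 1}
  set f : ℝ × ℝ → ℝ := S.indicator fun y => (1 + x1 * y.1 + x2 * y.2) ^ (-3 : ℤ) with hf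
  set G : ℝ → ℝ := fun x => (2 * x2)⁻¹ * ((1 + x1 * x + x2 * |1 - x|) ^ (-2 : ℤ) -
      (1 + x1 * x + x2 * (1 + x)) ^ (-2 : ℤ))
  obtain ⟨hGi, hGv⟩ := integrableOn_slice_and_integral x1 x2 h1 h2 h3
  have hSm : MeasurableSet S := by
    refine (measurableSet_lt measurable_const measurable_fst).inter
      ((measurableSet_lt measurable_const measurable_snd).inter
      ((measurableSet_le measurable_const (measurable_fst.add measurable_snd)).inter
      (measurableSet_le (continuous_fst.sub continuous_snd).abs.measurable measurable_const)))
  have hfm : Measurable f := by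
    refine Measurable.indicator ?_ hSm
    have : Measurable fun y : ℝ × ℝ => 1 + x1 * y.1 + x2 * y.2 := by fun_prop
    exact this.pow_const _
  have hf0 : ∀ p, 0 ≤ f p := fun p => by
    refine indicator_nonneg (fun y hy => ?_) p
    have h11 : 0 < x1 := h1.trans h2
    have := mul_pos h11 hy.1
    have := mul_pos h1 hy.2.1
    exact zpow_nonneg (by linarith) _
  have hslice : ∀ x, x ≠ 1 → 0 < x → (fun y => f (x, y)) =
      (Icc |1 - x| (1 + x)).indicator fun y => (1 + x1 * x + x2 * y) ^ (-3 : ℤ) := by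
    intro x hx hx0
    funext y
    by_cases hy : y ∈ Icc |1 - x| (1 + x)
    · rw [indicator_of_mem hy, hf,
        indicator_of_mem (show (x, y) ∈ S from (dual_domain_slice hx hx0 y).2 hy)]
    · rw [indicator_of_notMem hy, hf,
        indicator_of_notMem (show (x, y) ∉ S from fun h => hy ((dual_domain_slice hx hx0 y).1 h))]
  have hslice0 : ∀ x, ¬ 0 < x → (fun y => f (x, y)) = fun _ => 0 := by
    intro x hx
    funext y
    exact indicator_of_notMem (fun h => hx h.1) _
  have hpos : ∀ x, 0 < x → 0 < 1 + x1 * x + x2 * |1 - x| := fun x hx => by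
    have := mul_pos (h1.trans h2) hx
    have := mul_nonneg h1.le (abs_nonneg (1 - x))
    linarith
  have hne : ∀ᵐ x : ℝ, x ≠ 1 := by simp [ae_iff]
  have hsi : ∀ᵐ x : ℝ, Integrable fun y => f (x, y) := by
    filter_upwards [hne] with x hx
    by_cases hx0 : 0 < x
    · rw [hslice x hx hx0, integrable_indicator_iff measurableSet_Icc]
      refine (continuousOn_affine_zpow _ fun y hy => ?_).integrableOn_Icc
      have := mul_le_mul_of_nonneg_left hy.1 h1.le
      linarith [hpos x hx0]
    · rw [hslice0 x hx0]
      exact integrable_zero _ _ _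
  have hsv : (fun x => ∫ y, f (x, y)) =ᵐ[volume] (Ioi 0).indicator G := by
    filter_upwards [hne] with x hx
    by_cases hx0 : 0 < x
    · rw [hslice x hx hx0, integral_indicator measurableSet_Icc, indicator_of_mem (mem_Ioi.2 hx0),
        integral_Icc_affine_zpow_neg_three
          (abs_le.2 ⟨by linarith, by linarith⟩) h1 (hpos x hx0)]
    · rw [hslice0 x hx0, integral_zero, indicator_of_notMem (show x ∉ Ioi 0 from hx0)]
  have hfi : Integrable f (volume.prod volume) := by
    rw [integrable_prod_iff hfm.aestronglyMeasurable]
    refine ⟨hsi, ?_⟩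
    simp only [Real.norm_of_nonneg (hf0 _)]
    exact ((integrable_indicator_iff measurableSet_Ioi).2 hGi).congr hsv.symm
  rw [← integral_indicator hSm, ← hf, Measure.volume_eq_prod, integral_prod f hfi,
    integral_congr_ae hsv, integral_indicator measurableSet_Ioi, hGv]
end

section
/- The Reverse algorithm is full: for every i ∈ {1,2,3,4} and every y ∈ Δ there exists x ∈ Δ with x ∈ Δ(i) and f_R(x) = y; explicitly, one may take x = M_i·y/‖M_i·y‖₁. -/
open MeasureTheory Matrix

noncomputable section

/-- Membership in the cell Δ(i+1) of the Reverse algorithm (i : Fin 4). -/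
def inCell (i : Fin 4) (x : Fin 3 → ℝ) : Prop :=
  if i = 0 then 1 < 2 * x 0
  else if i = 1 then 1 < 2 * x 1
  else if i = 2 then 1 < 2 * x 2
  else ∀ j, 2 * x j ≤ 1

/-- `M_i y` in coordinates, for `y` in the open simplex. -/
theorem Mat_mulVec_of_mem_simplexOpen {y : Fin 3 → ℝ} (hy : y ∈ simplexOpen) (i : Fin 4) :
    (Mat i).mulVec y = ![![1, y 1, y 2], ![y 0, 1, y 2], ![y 0, y 1, 1],
      ![1 - y 0, 1 - y 1, 1 - y 2]] i := by
  have hsum := hy.2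
  ext j
  fin_cases i <;> fin_cases j <;>
    simp [Mat, M1, M2, M3, M4, mulVec, dotProduct, Fin.sum_univ_three] <;> linarith

/-- `‖M_i y‖₁`, for `y` in the open simplex. -/
theorem sum_abs_Mat_mulVec_of_mem_simplexOpen {y : Fin 3 → ℝ} (hy : y ∈ simplexOpen)
    (i : Fin 4) :
    ∑ j, |(Mat i).mulVec y j| = ![2 - y 0, 2 - y 1, 2 - y 2, 2] i := by
  obtain ⟨hpos, hsum⟩ := hy
  have h0 := hpos 0
  have h1 := hpos 1
  have h2 := hpos 2
  rw [Mat_mulVec_of_mem_simplexOpen ⟨hpos, hsum⟩, Fin.sum_univ_three]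
  fin_cases i <;> simp only [Fin.zero_eta, Fin.mk_one, Fin.reduceFinMk, cons_val] <;>
    rw [abs_of_pos (by linarith), abs_of_pos (by linarith), abs_of_pos (by linarith)] <;>
    linarith

/-- The Reverse algorithm is full: for every cell index i and every y in the open
simplex, the point `x = M_i·y/‖M_i·y‖₁` lies in the open simplex, belongs to the
cell Δ(i), and satisfies `f_R(x) = y`. -/
theorem reverse_full (i : Fin 4) (y : Fin 3 → ℝ) (hy : y ∈ simplexOpen) :
    (∑ j, |(Mat i).mulVec y j|)⁻¹ • (Mat i).mulVec y ∈ simplexOpen ∧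
    inCell i ((∑ j, |(Mat i).mulVec y j|)⁻¹ • (Mat i).mulVec y) ∧
    fR ((∑ j, |(Mat i).mulVec y j|)⁻¹ • (Mat i).mulVec y) = y := by
  rw [sum_abs_Mat_mulVec_of_mem_simplexOpen hy, Mat_mulVec_of_mem_simplexOpen hy]
  obtain ⟨hpos, hsum⟩ := hy
  have h0 := hpos 0
  have h1 := hpos 1
  have h2 := hpos 2
  have d0 : 0 < 2 - y 0 := by linarith
  have d1 : 0 < 2 - y 1 := by linarith
  have d2 : 0 < 2 - y 2 := by linarith
  refine ⟨⟨fun j => ?_, ?_⟩, ?_, ?_⟩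
  · fin_cases i <;> fin_cases j <;> simp <;> first | positivity | linarith
  · fin_cases i <;> simp <;> field_simp <;> linarith
  · fin_cases i
    · simp [inCell]; field_simp; linarith
    · simp [inCell]; field_simp; linarith
    · simp [inCell]; field_simp; linarith
    · simp [inCell, Fin.forall_fin_succ]; refine ⟨?_, ?_, ?_⟩ <;> linarith
  · fin_cases i
    · have c0 : 1 < 2 * (2 - y 0)⁻¹ := by field_simp; linarith
      ext j
      fin_cases j <;> simp [fR, c0] <;> field_simp <;> linarith
    · have c0 : ¬ 1 < 2 * ((2 - y 1)⁻¹ * y 0) := by field_simp; linarith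
      have c1 : 1 < 2 * (2 - y 1)⁻¹ := by field_simp; linarith
      ext j
      fin_cases j <;> simp [fR, c0, c1] <;> field_simp <;> linarith
    · have c0 : ¬ 1 < 2 * ((2 - y 2)⁻¹ * y 0) := by field_simp; linarith
      have c1 : ¬ 1 < 2 * ((2 - y 2)⁻¹ * y 1) := by field_simp; linarith
      have c2 : 1 < 2 * (2 - y 2)⁻¹ := by field_simp; linarith
      ext j
      fin_cases j <;> simp [fR, c0, c1, c2] <;> field_simp <;> linarith
    · simp only [fR]
      rw [if_neg (by simp; linarith), if_neg (by simp; linarith), if_neg (by simp; linarith)]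
      ext j
      fin_cases j <;> simp <;> linarith

end
end
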